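/- arXiv:1909.12994 — 3 statements merged into one kernel-verified Lean document; each statement's English description precedes it below -/
import Mathlib

section
/- Fix natural numbers n, k₁, k₂. Let B(n;k₁,k₂) denote the set of crossingless matchings a of the n+k₁+k₂ points {1,…,n+k₁+k₂} such that a matches no two of the first k₁ points to each other and no two of the last k₂ points to each other. Then the map ι (adding an outermost arc) sends B(n;k₁,k₂) into B(n;k₁+1,k₂+1), and if k₁+k₂ ≥ n then ι : B(n;k₁,k₂) → B(n;k₁+1,k₂+1) is a bijection. -/
/-- `a` is a crossingless matching of the `m` points `{1,…,m}`: a fixed-point-free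
involution of `{1,…,m}` with no indices `i < j < a i < a j`.  Functions are
normalized to be the identity outside `{1,…,m}`, so that a crossingless matching
is determined by the function `a : ℕ → ℕ`. -/
def IsCrossinglessMatching (m : ℕ) (a : ℕ → ℕ) : Prop :=
  (∀ i, 1 ≤ i → i ≤ m → 1 ≤ a i ∧ a i ≤ m) ∧
  (∀ i, 1 ≤ i → i ≤ m → a (a i) = i) ∧
  (∀ i, 1 ≤ i → i ≤ m → a i ≠ i) ∧
  (∀ i j, 1 ≤ i → i < j → j < a i → ¬ a i < a j) ∧
  (∀ i, i = 0 ∨ m < i → a i = i)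

/-- `B(n;k₁,k₂)`: crossingless matchings of the `n+k₁+k₂` points `{1,…,n+k₁+k₂}`
matching no two of the first `k₁` points to each other and no two of the last
`k₂` points to each other. -/
def IsPlatformMatching (n k₁ k₂ : ℕ) (a : ℕ → ℕ) : Prop :=
  IsCrossinglessMatching (n + k₁ + k₂) a ∧
  (∀ i j, 1 ≤ i → i ≤ k₁ → 1 ≤ j → j ≤ k₁ → i ≠ j → a i ≠ j) ∧
  (∀ i j, n + k₁ + 1 ≤ i → i ≤ n + k₁ + k₂ → n + k₁ + 1 ≤ j → j ≤ n + k₁ + k₂ →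
    i ≠ j → a i ≠ j)

/-- The map `ι` adding an outermost arc: `ι(a)(1) = m+2`, `ι(a)(m+2) = 1`, and
`ι(a)(i) = a(i−1)+1` for `2 ≤ i ≤ m+1` (and the identity outside `{1,…,m+2}`). -/
def iota (m : ℕ) (a : ℕ → ℕ) : ℕ → ℕ := fun i =>
  if i = 1 then m + 2
  else if i = m + 2 then 1
  else if 2 ≤ i ∧ i ≤ m + 1 then a (i - 1) + 1
  else i

theorem iota_one (m : ℕ) (a : ℕ → ℕ) : iota m a 1 = m + 2 := by simp [iota]

theorem iota_last (m : ℕ) (a : ℕ → ℕ) : iota m a (m + 2) = 1 := by simp [iota]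

theorem iota_succ {m : ℕ} (a : ℕ → ℕ) {i : ℕ} (h1 : 1 ≤ i) (hm : i ≤ m) :
    iota m a (i + 1) = a i + 1 := by
  grind [iota]

theorem iota_of_outside {m : ℕ} (a : ℕ → ℕ) {i : ℕ} (h : i = 0 ∨ m + 2 < i) :
    iota m a i = i := by
  grind [iota]

theorem eq_outer_or_inner (m i : ℕ) :
    (i = 0 ∨ m + 2 < i) ∨ i = 1 ∨ i = m + 2 ∨ ∃ j, 1 ≤ j ∧ j ≤ m ∧ i = j + 1 := by
  by_cases h : 2 ≤ i ∧ i ≤ m + 1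
  · exact .inr (.inr (.inr ⟨i - 1, by omega, by omega, by omega⟩))
  · omega

theorem IsCrossinglessMatching.iota {m : ℕ} {a : ℕ → ℕ} (ha : IsCrossinglessMatching m a) :
    IsCrossinglessMatching (m + 2) (iota m a) := by
  obtain ⟨hr, hi, hf, hc, ho⟩ := ha
  refine ⟨fun i h1 h2 => ?_, fun i h1 h2 => ?_, fun i h1 h2 => ?_, fun i j h1 hij hj h => ?_,
    fun i h => iota_of_outside a h⟩
  · rcases eq_outer_or_inner m i with h | rfl | rfl | ⟨j, hj1, hjm, rfl⟩
    · omega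
    · rw [iota_one]; omega
    · rw [iota_last]; omega
    · rw [iota_succ a hj1 hjm]; have := hr j hj1 hjm; omega
  · rcases eq_outer_or_inner m i with h | rfl | rfl | ⟨j, hj1, hjm, rfl⟩
    · omega
    · rw [iota_one, iota_last]
    · rw [iota_last, iota_one]
    · obtain ⟨h3, h4⟩ := hr j hj1 hjm
      rw [iota_succ a hj1 hjm, iota_succ a h3 h4, hi j hj1 hjm]
  · rcases eq_outer_or_inner m i with h | rfl | rfl | ⟨j, hj1, hjm, rfl⟩
    · omega
    · rw [iota_one]; omega
    · rw [iota_last]; omega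
    · rw [iota_succ a hj1 hjm]; have := hf j hj1 hjm; omega
  · rcases eq_outer_or_inner m i with hi' | rfl | rfl | ⟨i, hi1, him, rfl⟩
    · rw [iota_of_outside a hi'] at hj; omega
    · rw [iota_one] at hj h
      rcases eq_outer_or_inner m j with hj' | rfl | rfl | ⟨j, hj1, hjm, rfl⟩
      · omega
      · omega
      · omega
      · rw [iota_succ a hj1 hjm] at h; have := hr j hj1 hjm; omega
    · rw [iota_last] at hj; omega
    · rw [iota_succ a hi1 him] at hj h
      have := hr i hi1 him
      obtain ⟨j, rfl⟩ : ∃ k, j = k + 1 := ⟨j - 1, by omega⟩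
      rw [iota_succ a (by omega) (by omega)] at h
      exact hc i j hi1 (by omega) (by omega) (by omega)

theorem IsPlatformMatching.iota {n k₁ k₂ : ℕ} {a : ℕ → ℕ} (ha : IsPlatformMatching n k₁ k₂ a) :
    IsPlatformMatching n (k₁ + 1) (k₂ + 1) (iota (n + k₁ + k₂) a) := by
  obtain ⟨hm, hp, hq⟩ := ha
  refine ⟨?_, fun i j hi1 hi hj1 hj hij h => ?_, fun i j hi1 hi hj1 hj hij h => ?_⟩
  · rw [show n + (k₁ + 1) + (k₂ + 1) = n + k₁ + k₂ + 2 by omega]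
    exact hm.iota
  · rcases eq_outer_or_inner (n + k₁ + k₂) i with hi' | rfl | rfl | ⟨i, h1, him, rfl⟩
    · omega
    · rw [iota_one] at h; omega
    · omega
    · rw [iota_succ a h1 him] at h
      have := hm.1 i h1 him
      exact hp i (j - 1) h1 (by omega) (by omega) (by omega) (by omega) (by omega)
  · rcases eq_outer_or_inner (n + k₁ + k₂) i with hi' | rfl | rfl | ⟨i, h1, him, rfl⟩
    · omega
    · omega
    · rw [iota_last] at h; omega
    · rw [iota_succ a h1 him] at h
      have := hm.1 i h1 him
      exact hq i (j - 1) (by omega) (by omega) (by omega) (by omega) (by omega) (by omega)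

theorem iota_injOn (m : ℕ) : Set.InjOn (iota m) {a | IsCrossinglessMatching m a} := by
  intro a ha b hb h
  funext i
  by_cases hi : i = 0 ∨ m < i
  · rw [ha.2.2.2.2 i hi, hb.2.2.2.2 i hi]
  · have := congrFun h (i + 1)
    rw [iota_succ a (by omega) (by omega), iota_succ b (by omega) (by omega)] at this
    omega

theorem IsCrossinglessMatching.injOn {m : ℕ} {a : ℕ → ℕ} (ha : IsCrossinglessMatching m a) :
    Set.InjOn a (Set.Icc 1 m) := by
  intro i hi j hj h
  rw [← ha.2.1 i hi.1 hi.2, h, ha.2.1 j hj.1 hj.2]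

/-- If both platforms are nonempty and together they have more than `n` points, then the first
and the last point are matched to each other. -/
theorem IsPlatformMatching.apply_one {n k₁ k₂ : ℕ} {b : ℕ → ℕ}
    (hb : IsPlatformMatching n k₁ k₂ b) (h₁ : 1 ≤ k₁) (h₂ : 1 ≤ k₂) (hn : n < k₁ + k₂) :
    b 1 = n + k₁ + k₂ := by
  obtain ⟨hm, hp, hq⟩ := hb
  have hinj := hm.injOn
  obtain ⟨hr, hi, hf, hc, -⟩ := hm
  by_contra hne
  have r1 := hr 1 le_rfl (by omega)
  have rM := hr (n + k₁ + k₂) (by omega) le_rfl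
  have i1 := hi 1 le_rfl (by omega)
  have iM := hi (n + k₁ + k₂) (by omega) le_rfl
  have f1 := hf 1 le_rfl (by omega)
  have hpk : k₁ < b 1 := by
    by_contra h
    exact hp 1 (b 1) le_rfl h₁ r1.1 (by omega) (Ne.symm f1) rfl
  have hqk : b (n + k₁ + k₂) ≤ n + k₁ := by
    by_contra h
    exact hq (n + k₁ + k₂) (b (n + k₁ + k₂)) (by omega) le_rfl (by omega) rM.2
      (Ne.symm (hf _ (by omega) le_rfl)) rfl
  have hpq : b 1 < b (n + k₁ + k₂) := by
    by_contra h
    have hq1 : b (n + k₁ + k₂) ≠ 1 := by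
      intro h'; rw [h'] at iM; omega
    have hqp : b (n + k₁ + k₂) ≠ b 1 := by
      intro h'; rw [h', i1] at iM; omega
    exact hc 1 (b (n + k₁ + k₂)) le_rfl (by omega) (by omega) (by omega)
  have hleft : k₁ ≤ b 1 - k₁ := by
    have := Finset.card_le_card_of_injOn (s := Finset.Icc 1 k₁) (t := Finset.Ioc k₁ (b 1)) b
      (fun j hj => ?_) (hinj.mono fun j hj => ?_)
    · simpa using this
    · simp only [Finset.coe_Icc, Set.mem_Icc] at hj
      have rj := hr j hj.1 (by omega)
      simp only [Finset.coe_Ioc, Set.mem_Ioc]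
      constructor
      · by_contra h
        exact hp j (b j) hj.1 hj.2 rj.1 (by omega) (Ne.symm (hf j hj.1 (by omega))) rfl
      · rcases hj.1.eq_or_lt with rfl | h
        · rfl
        · exact not_lt.1 (hc 1 j le_rfl h (by omega))
    · simp only [Finset.coe_Icc, Set.mem_Icc] at hj ⊢
      omega
  have hright : k₂ ≤ n + k₁ + 1 - b (n + k₁ + k₂) := by
    have := Finset.card_le_card_of_injOn (s := Finset.Ioc (n + k₁) (n + k₁ + k₂))
      (t := Finset.Icc (b (n + k₁ + k₂)) (n + k₁)) b
      (fun j hj => ?_) (hinj.mono fun j hj => ?_)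
    · simpa using this
    · simp only [Finset.coe_Ioc, Set.mem_Ioc] at hj
      have rj := hr j (by omega) (by omega)
      have ij := hi j (by omega) (by omega)
      simp only [Finset.coe_Icc, Set.mem_Icc]
      constructor
      · rcases hj.2.eq_or_lt with rfl | h
        · rfl
        · by_contra h'
          exact hc (b j) (b (n + k₁ + k₂)) rj.1 (by omega) (by omega) (by omega)
      · by_contra h
        exact hq j (b j) (by omega) hj.2 (by omega) rj.2
          (Ne.symm (hf j (by omega) (by omega))) rfl
    · simp only [Finset.coe_Ioc, Set.mem_Ioc, Set.mem_Icc] at hj ⊢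
      omega
  omega

/-- Removes the outermost arc of a matching of `m + 2` points. -/
def removeOuterArc (m : ℕ) (b : ℕ → ℕ) : ℕ → ℕ := fun i =>
  if 1 ≤ i ∧ i ≤ m then b (i + 1) - 1 else i

theorem IsCrossinglessMatching.apply_succ_mem {m : ℕ} {b : ℕ → ℕ}
    (hb : IsCrossinglessMatching (m + 2) b) (h : b 1 = m + 2) {i : ℕ} (h1 : 1 ≤ i) (hm : i ≤ m) :
    2 ≤ b (i + 1) ∧ b (i + 1) ≤ m + 1 := by
  have hr := hb.1 (i + 1) (by omega) (by omega)
  have hi := hb.2.1 (i + 1) (by omega) (by omega)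
  have hi1 := hb.2.1 1 le_rfl (by omega)
  rw [h] at hi1
  have h2 : b (i + 1) ≠ 1 := by intro h'; rw [h'] at hi; omega
  have h3 : b (i + 1) ≠ m + 2 := by intro h'; rw [h'] at hi; omega
  omega

theorem removeOuterArc_add_one {m : ℕ} {b : ℕ → ℕ} (hb : IsCrossinglessMatching (m + 2) b)
    (h : b 1 = m + 2) {i : ℕ} (h1 : 1 ≤ i) (hm : i ≤ m) :
    removeOuterArc m b i + 1 = b (i + 1) := by
  have := hb.apply_succ_mem h h1 hm
  rw [removeOuterArc, if_pos ⟨h1, hm⟩]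
  omega

theorem iota_removeOuterArc {m : ℕ} {b : ℕ → ℕ} (hb : IsCrossinglessMatching (m + 2) b)
    (h : b 1 = m + 2) : iota m (removeOuterArc m b) = b := by
  funext i
  rcases eq_outer_or_inner m i with hi | rfl | rfl | ⟨j, hj1, hjm, rfl⟩
  · rw [iota_of_outside _ hi, hb.2.2.2.2 i hi]
  · rw [iota_one, h]
  · rw [iota_last, ← h, hb.2.1 1 le_rfl (by omega)]
  · rw [iota_succ _ hj1 hjm, removeOuterArc_add_one hb h hj1 hjm]

theorem IsCrossinglessMatching.removeOuterArc {m : ℕ} {b : ℕ → ℕ}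
    (hb : IsCrossinglessMatching (m + 2) b) (h : b 1 = m + 2) :
    IsCrossinglessMatching m (removeOuterArc m b) := by
  have hs : ∀ {i}, 1 ≤ i → i ≤ m → _ := removeOuterArc_add_one hb h
  have hmem : ∀ {i}, 1 ≤ i → i ≤ m → _ := hb.apply_succ_mem h
  have ho : ∀ i, i = 0 ∨ m < i → _root_.removeOuterArc m b i = i := fun i hi => by
    rw [_root_.removeOuterArc, if_neg (by omega)]
  refine ⟨fun i h1 h2 => ?_, fun i h1 h2 => ?_, fun i h1 h2 => ?_, fun i j h1 hij hj h' => ?_, ho⟩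
  · have := hs h1 h2; have := hmem h1 h2; omega
  · have e := hs h1 h2
    have := hmem h1 h2
    have e' := hs (i := _root_.removeOuterArc m b i) (by omega) (by omega)
    rw [e, hb.2.1 (i + 1) (by omega) (by omega)] at e'
    omega
  · have := hs h1 h2; have := hb.2.2.1 (i + 1) (by omega) (by omega); omega
  · have him : i ≤ m := by
      by_contra hi; rw [ho i (by omega)] at hj; omega
    have := hs h1 him
    have := hmem h1 him
    have := hs (i := j) (by omega) (by omega)
    exact hb.2.2.2.1 (i + 1) (j + 1) (by omega) (by omega) (by omega) (by omega)

theorem IsPlatformMatching.removeOuterArc {n k₁ k₂ : ℕ} {b : ℕ → ℕ}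
    (hb : IsPlatformMatching n (k₁ + 1) (k₂ + 1) b) (h : b 1 = n + k₁ + k₂ + 2) :
    IsPlatformMatching n k₁ k₂ (removeOuterArc (n + k₁ + k₂) b) := by
  obtain ⟨hm, hp, hq⟩ := hb
  rw [show n + (k₁ + 1) + (k₂ + 1) = n + k₁ + k₂ + 2 by omega] at hm
  refine ⟨hm.removeOuterArc h, fun i j hi1 hi hj1 hj hij hab => ?_,
    fun i j hi1 hi hj1 hj hij hab => ?_⟩
  all_goals have := removeOuterArc_add_one hm h (i := i) (by omega) (by omega)
  · exact hp (i + 1) (j + 1) (by omega) (by omega) (by omega) (by omega) (by omega) (by omega)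
  · exact hq (i + 1) (j + 1) (by omega) (by omega) (by omega) (by omega) (by omega) (by omega)

/-- The map `ι` sends `B(n;k₁,k₂)` into `B(n;k₁+1,k₂+1)`, and is a bijection
between these two sets whenever `k₁ + k₂ ≥ n`. -/
theorem iota_maps_platform_and_bijOn (n k₁ k₂ : ℕ) :
    (∀ a : ℕ → ℕ, IsPlatformMatching n k₁ k₂ a →
      IsPlatformMatching n (k₁ + 1) (k₂ + 1) (iota (n + k₁ + k₂) a)) ∧
    (k₁ + k₂ ≥ n →
      Set.BijOn (iota (n + k₁ + k₂))
        {a : ℕ → ℕ | IsPlatformMatching n k₁ k₂ a}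
        {a : ℕ → ℕ | IsPlatformMatching n (k₁ + 1) (k₂ + 1) a}) := by
  refine ⟨fun a ha => ha.iota, fun hn => ⟨fun a ha => ha.iota,
    (iota_injOn _).mono fun a ha => ha.1, fun b hb => ?_⟩⟩
  have h : b 1 = n + k₁ + k₂ + 2 := by
    rw [hb.apply_one (by omega) (by omega) (by omega)]
    omega
  refine ⟨removeOuterArc (n + k₁ + k₂) b, hb.removeOuterArc h, iota_removeOuterArc ?_ h⟩
  rw [show n + k₁ + k₂ + 2 = n + (k₁ + 1) + (k₂ + 1) by omega]
  exact hb.1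
end

section
/- Fix natural numbers n, k₁, k₂ with k₁+k₂ ≥ n, and let a be a crossingless matching of the n+k₁+k₂+2 points {1,…,n+k₁+k₂+2} that matches no two of the first k₁+1 points to each other and no two of the last k₂+1 points to each other. Then a matches the first point to the last point: a(1) = n+k₁+k₂+2. -/
/-- If `k₁ + k₂ ≥ n` and `a ∈ B(n;k₁+1,k₂+1)` (a crossingless matching of the
`n+k₁+k₂+2` points matching no two of the first `k₁+1` points to each other and
no two of the last `k₂+1` points to each other), then `a` matches the first
point to the last point: `a 1 = n+k₁+k₂+2`. -/
theorem platformMatching_first_matched_to_last (n k₁ k₂ : ℕ) (h : k₁ + k₂ ≥ n)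
    (a : ℕ → ℕ) (ha : IsPlatformMatching n (k₁ + 1) (k₂ + 1) a) :
    a 1 = n + k₁ + k₂ + 2 := by
  obtain ⟨⟨hrange, hinv, hfix, hcross, -⟩, hfirst, hlast⟩ := ha
  by_contra hne
  -- Noncrossing for an arc given by its left endpoint `i` and one given by its right endpoint `j`.
  have nocross : ∀ i j, 1 ≤ i → 1 ≤ j → j ≤ n + k₁ + k₂ + 2 → i < a j → a j < a i → ¬ a i < j := by
    intro i j hi hj hjm h₁ h₂ h₃
    have := hcross i (a j) hi h₁ h₂
    rw [hinv j hj (by omega)] at this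
    exact this h₃
  have first_gt : ∀ i, 1 ≤ i → i ≤ k₁ + 1 → k₁ + 2 ≤ a i := by
    intro i h₁ h₂
    have := hrange i h₁ (by omega)
    have := hfix i h₁ (by omega)
    by_contra hc
    exact hfirst i (a i) h₁ h₂ (by omega) (by omega) (by omega) rfl
  have last_lt : ∀ j, n + k₁ + 2 ≤ j → j ≤ n + k₁ + k₂ + 2 → a j ≤ n + k₁ + 1 := by
    intro j h₁ h₂
    have := hrange j (by omega) (by omega)
    have := hfix j (by omega) (by omega)
    by_contra hc
    exact hlast j (a j) (by omega) (by omega) (by omega) (by omega) (by omega) rfl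
  have a_one_gt := first_gt 1 (by omega) (by omega)
  have a_one_le := hrange 1 (by omega) (by omega)
  have a_a_one := hinv 1 (by omega) (by omega)
  set m := n + k₁ + k₂ + 2 with hm
  have a_m_le := last_lt m (by omega) le_rfl
  have a_m_range := hrange m (by omega) (by omega)
  have a_a_m := hinv m (by omega) (by omega)
  have a_one_lt_a_m : a 1 < a m := by
    have h₁ : a m ≠ 1 := by intro h'; rw [h'] at a_a_m; exact hne a_a_m
    have h₂ : a m ≠ a 1 := by intro h'; rw [h', a_a_one] at a_a_m; omega
    have := nocross 1 m (by omega) (by omega) le_rfl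
    omega
  have first_le : ∀ i, 1 ≤ i → i ≤ k₁ + 1 → a i ≤ a 1 := by
    intro i h₁ h₂
    rcases h₁.eq_or_lt with rfl | h₁'
    · exact le_rfl
    · have := hcross 1 i le_rfl h₁' (by omega)
      omega
  have last_ge : ∀ j, n + k₁ + 2 ≤ j → j ≤ m → a m ≤ a j := by
    intro j h₁ h₂
    rcases h₂.eq_or_lt with rfl | h₂'
    · exact le_rfl
    · have h₃ := nocross (a j) m (hrange j (by omega) (by omega)).1 (by omega) le_rfl
      rw [hinv j (by omega) (by omega)] at h₃
      omega
  have hcard := Finset.card_le_card_of_injOn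
    (s := Finset.Icc 1 (k₁ + 1) ∪ Finset.Icc (n + k₁ + 2) m)
    (t := Finset.Icc (k₁ + 2) (n + k₁ + 1)) a
    (by
      intro i hi
      simp only [Finset.coe_union, Finset.coe_Icc, Set.mem_union, Set.mem_Icc] at hi ⊢
      rcases hi with ⟨h₁, h₂⟩ | ⟨h₁, h₂⟩
      · have := first_gt i h₁ h₂
        have := first_le i h₁ h₂
        omega
      · have := last_lt i h₁ h₂
        have := last_ge i h₁ h₂
        omega)
    (by
      intro i hi j hj hij
      simp only [Finset.coe_union, Finset.coe_Icc, Set.mem_union, Set.mem_Icc] at hi hj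
      rw [← hinv i (by omega) (by omega), hij, hinv j (by omega) (by omega)])
  rw [Finset.card_union_of_disjoint
    (Finset.disjoint_left.2 fun i h₁ h₂ => by simp only [Finset.mem_Icc] at h₁ h₂; omega)] at hcard
  simp only [Nat.card_Icc] at hcard
  omega
end

section
/- Fix natural numbers 0 ≤ k ≤ n. Let B(n;n−k,k) be the set of crossingless matchings of the 2n points {1,…,2n} that match no two of the first n−k points to each other and no two of the last k points to each other, and call the n points {n−k+1,…,2n−k} the middle points. For a ∈ B(n;n−k,k), let S_a be the set of middle points i with a(i) > i (middle points matched to a strictly larger point). Then for every a ∈ B(n;n−k,k) the set S_a has exactly k elements, and the map a ↦ S_a is a bijection from B(n;n−k,k) onto the collection of k-element subsets of the middle points. -/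
/-- The set `S_a` associated to `a ∈ B(n;n−k,k)`: those of the middle points
`{n−k+1,…,2n−k}` that `a` matches to a strictly larger point. -/
def middleUpSet (n k : ℕ) (a : ℕ → ℕ) : Finset ℕ :=
  (Finset.Icc (n - k + 1) (2 * n - k)).filter (fun i => i < a i)

/-- Exactly half of the points are matched to a strictly larger point. -/
theorem IsCrossinglessMatching.two_mul_card_openers {m : ℕ} {a : ℕ → ℕ}
    (ha : IsCrossinglessMatching m a) :
    2 * ((Finset.Icc 1 m).filter (fun i => i < a i)).card = m := by
  obtain ⟨hr, hi, hf, -, -⟩ := ha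
  have h1 := Finset.card_filter_add_card_filter_not (s := Finset.Icc 1 m) (fun i => i < a i)
  have h2 : ((Finset.Icc 1 m).filter (fun i => i < a i)).card =
      ((Finset.Icc 1 m).filter (fun i => ¬ i < a i)).card := by
    refine Finset.card_nbij' a a ?_ ?_ ?_ ?_
    all_goals
      intro i h
      simp only [Finset.coe_filter, Finset.mem_Icc, Set.mem_ofPred_eq] at h ⊢
      obtain ⟨⟨h1, h2⟩, h3⟩ := h
      have := hr i h1 h2
      have := hi i h1 h2
      have := hf i h1 h2
      omega
  simp only [Nat.card_Icc] at h1
  omega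

/-- A crossingless matching is determined at the points matched to a larger point by the set of
these points. -/
theorem IsCrossinglessMatching.apply_eq_of_lt {m : ℕ} {a b : ℕ → ℕ}
    (ha : IsCrossinglessMatching m a) (hb : IsCrossinglessMatching m b)
    (hab : ∀ i, 1 ≤ i → i ≤ m → (i < a i ↔ i < b i)) (d : ℕ) :
    ∀ i, 1 ≤ i → i ≤ m → i < a i → a i - i ≤ d → a i = b i := by
  obtain ⟨har, hai, haf, hac, -⟩ := ha
  obtain ⟨hbr, hbi, hbf, hbc, -⟩ := hb
  induction d with
  | zero => intros; omega
  | succ d ih =>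
    intro i h1 h2 h3 h4
    have hib := (hab i h1 h2).1 h3
    have hai1 := har i h1 h2
    have hbi1 := hbr i h1 h2
    have hai2 := hai i h1 h2
    have hbi2 := hbi i h1 h2
    rcases lt_trichotomy (a i) (b i) with h | h | h
    · have hj := hab (a i) hai1.1 hai1.2
      have hj1 := hbr (a i) hai1.1 hai1.2
      have hj2 := hbi (a i) hai1.1 hai1.2
      have hj3 := hbf (a i) hai1.1 hai1.2
      have hl : i < b (a i) := by
        have := hbc (b (a i)) i hj1.1
        rw [hj2] at this
        by_contra hlt
        rcases eq_or_lt_of_le (not_lt.1 hlt) with he | he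
        · rw [he] at hj2; omega
        · exact this he h3 h
      have hl2 := (hab (b (a i)) hj1.1 hj1.2).2 (by omega)
      have hl3 := hac i (b (a i)) h1 hl (by omega)
      have := ih (b (a i)) hj1.1 hj1.2 hl2 (by omega)
      rw [hj2] at this
      have h5 := hai (b (a i)) hj1.1 hj1.2
      rw [this, hai2] at h5
      omega
    · exact h
    · have hj := hab (b i) hbi1.1 hbi1.2
      have hj1 := har (b i) hbi1.1 hbi1.2
      have hj2 := hai (b i) hbi1.1 hbi1.2
      have hj3 := haf (b i) hbi1.1 hbi1.2
      have hl : i < a (b i) := by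
        have := hac (a (b i)) i hj1.1
        rw [hj2] at this
        by_contra hlt
        rcases eq_or_lt_of_le (not_lt.1 hlt) with he | he
        · rw [he] at hj2; omega
        · exact this he hib h
      have := ih (a (b i)) hj1.1 hj1.2 (by omega) (by omega)
      rw [hj2] at this
      have h5 := hbi (a (b i)) hj1.1 hj1.2
      rw [← this, hbi2] at h5
      omega

/-- A crossingless matching is determined by the set of points matched to a larger point. -/
theorem IsCrossinglessMatching.ext_openers {m : ℕ} {a b : ℕ → ℕ}
    (ha : IsCrossinglessMatching m a) (hb : IsCrossinglessMatching m b)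
    (hab : ∀ i, 1 ≤ i → i ≤ m → (i < a i ↔ i < b i)) : a = b := by
  have key := fun i h1 h2 h3 => ha.apply_eq_of_lt hb hab (a i - i) i h1 h2 h3 le_rfl
  obtain ⟨har, hai, haf, -, ha0⟩ := ha
  obtain ⟨hbr, hbi, -, -, hb0⟩ := hb
  funext i
  by_cases h : 1 ≤ i ∧ i ≤ m
  · obtain ⟨h1, h2⟩ := h
    by_cases h3 : i < a i
    · exact key i h1 h2 h3
    · have hr := har i h1 h2
      have h4 := hai i h1 h2
      have h5 := haf i h1 h2
      have h6 := key (a i) hr.1 hr.2 (by omega)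
      have h7 := hbi (a i) hr.1 hr.2
      rw [← h6, h4] at h7
      exact h7.symm
  · rw [ha0 i (by omega), hb0 i (by omega)]

/-- The points `i` and `j` bound an excursion of the lattice path `h`: the step of `h` ending at
`i` is undone for the first time by the step ending at `j`. -/
def IsExcursion (h : ℕ → ℤ) (i j : ℕ) : Prop :=
  1 ≤ i ∧ i < j ∧ h (i - 1) = h j ∧ ∀ l, i ≤ l → l < j → h j < h l

theorem IsExcursion.right_unique {h : ℕ → ℤ} {i j j' : ℕ} (hj : IsExcursion h i j)
    (hj' : IsExcursion h i j') : j = j' := by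
  obtain ⟨-, h1, h2, h3⟩ := hj
  obtain ⟨-, h1', h2', h3'⟩ := hj'
  rcases lt_trichotomy j j' with hlt | heq | hlt
  · have := h3' j (by omega) hlt; omega
  · exact heq
  · have := h3 j' (by omega) hlt; omega

theorem IsExcursion.left_unique {h : ℕ → ℤ} {i i' j : ℕ} (hi : IsExcursion h i j)
    (hi' : IsExcursion h i' j) : i = i' := by
  obtain ⟨h0, h1, h2, h3⟩ := hi
  obtain ⟨h0', h1', h2', h3'⟩ := hi'
  rcases lt_trichotomy i i' with hlt | heq | hlt
  · have := h3 (i' - 1) (by omega) (by omega); omega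
  · exact heq
  · have := h3' (i - 1) (by omega) (by omega); omega

theorem IsExcursion.lt_left {h : ℕ → ℤ} {i j : ℕ} (hij : IsExcursion h i j) :
    h (i - 1) < h i := by
  obtain ⟨-, h1, h2, h3⟩ := hij
  have := h3 i le_rfl h1
  omega

theorem IsExcursion.lt_right {h : ℕ → ℤ} {i j : ℕ} (hij : IsExcursion h i j) :
    h j < h (j - 1) := by
  obtain ⟨-, h1, -, h3⟩ := hij
  exact h3 (j - 1) (by omega) (by omega)

/-- In a lattice path with steps at least `-1`, every step up to a level above the end level
starts an excursion. -/
theorem exists_isExcursion_right {h : ℕ → ℤ} {m i : ℕ} (hs : ∀ j, h j ≤ h (j + 1) + 1)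
    (hi1 : 1 ≤ i) (hi : i ≤ m) (hup : h (i - 1) < h i) (hm : h m ≤ h (i - 1)) :
    ∃ j ≤ m, IsExcursion h i j := by
  classical
  have hex : ∃ j, i ≤ j ∧ h j ≤ h (i - 1) := ⟨m, hi, hm⟩
  obtain ⟨hj1, hj2⟩ := Nat.find_spec hex
  have hmin : ∀ l, i ≤ l → l < Nat.find hex → h (i - 1) < h l := fun l h1 h2 => by
    have := Nat.find_min hex h2
    simp only [not_and, not_le] at this
    exact this h1
  have hle : Nat.find hex ≤ m := Nat.find_min' hex ⟨hi, hm⟩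
  generalize Nat.find hex = j at *
  have hij : i < j := lt_of_le_of_ne hj1 (by rintro rfl; omega)
  have h1 := hmin (j - 1) (by omega) (by omega)
  have h2 := hs (j - 1)
  rw [Nat.sub_add_cancel (by omega)] at h2
  refine ⟨j, hle, hi1, hij, by omega, fun l h3 h4 => ?_⟩
  have := hmin l h3 h4
  omega

/-- In a lattice path with steps at most `1`, every step down to a level not below the start
ends an excursion. -/
theorem exists_isExcursion_left {h : ℕ → ℤ} {j : ℕ} (hs : ∀ j, h (j + 1) ≤ h j + 1)
    (hj1 : 1 ≤ j) (hdown : h j < h (j - 1)) (h0 : h 0 ≤ h j) :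
    ∃ i, IsExcursion h i j := by
  classical
  have hp := Nat.findGreatest_spec (P := fun l => h l ≤ h j) (Nat.zero_le (j - 1)) h0
  have hmax : ∀ l, Nat.findGreatest (fun l => h l ≤ h j) (j - 1) < l → l ≤ j - 1 → h j < h l :=
    fun l h1 h2 => not_le.1 (Nat.findGreatest_is_greatest h1 h2)
  have hle := Nat.findGreatest_le (P := fun l => h l ≤ h j) (j - 1)
  generalize Nat.findGreatest (fun l => h l ≤ h j) (j - 1) = p at *
  have hpj : p < j - 1 := lt_of_le_of_ne hle (by rintro rfl; omega)
  have h1 := hmax (p + 1) (by omega) (by omega)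
  have h2 := hs p
  refine ⟨p + 1, by omega, by omega, ?_, fun l h3 h4 => hmax l (by omega) (by omega)⟩
  rw [Nat.add_sub_cancel]
  omega

open Classical in
/-- The involution exchanging the two ends of every excursion of `h`. -/
noncomputable def excursionSwap (h : ℕ → ℤ) (i : ℕ) : ℕ :=
  if hr : ∃ j, IsExcursion h i j then hr.choose
  else if hl : ∃ j, IsExcursion h j i then hl.choose else i

theorem excursionSwap_left {h : ℕ → ℤ} {i j : ℕ} (hij : IsExcursion h i j) :
    excursionSwap h i = j := by
  have hr : ∃ j, IsExcursion h i j := ⟨j, hij⟩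
  rw [excursionSwap, dif_pos hr]
  exact hr.choose_spec.right_unique hij

theorem excursionSwap_right {h : ℕ → ℤ} {i j : ℕ} (hij : IsExcursion h i j) :
    excursionSwap h j = i := by
  have hl : ∃ i, IsExcursion h i j := ⟨i, hij⟩
  have hr : ¬ ∃ l, IsExcursion h j l := fun ⟨l, hjl⟩ => by
    have := hjl.lt_left
    have := hij.lt_right
    omega
  rw [excursionSwap, dif_neg hr, dif_pos hl]
  exact hl.choose_spec.left_unique hij

theorem excursionSwap_of_not {h : ℕ → ℤ} {i : ℕ} (hr : ¬ ∃ j, IsExcursion h i j)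
    (hl : ¬ ∃ j, IsExcursion h j i) : excursionSwap h i = i := by
  rw [excursionSwap, dif_neg hr, dif_neg hl]

theorem isExcursion_of_lt_excursionSwap {h : ℕ → ℤ} {i : ℕ} (hi : i < excursionSwap h i) :
    IsExcursion h i (excursionSwap h i) := by
  by_cases hr : ∃ j, IsExcursion h i j
  · obtain ⟨j, hj⟩ := hr
    rwa [excursionSwap_left hj]
  · by_cases hl : ∃ j, IsExcursion h j i
    · obtain ⟨j, hj⟩ := hl
      rw [excursionSwap_right hj] at hi
      have := hj.2.1
      omega
    · rw [excursionSwap_of_not hr hl] at hi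
      omega

/-- Swapping the ends of the excursions of a nonnegative lattice path from `0` to `0` of length
`m`, which steps up at the points of `O`, gives a crossingless matching. -/
theorem isCrossinglessMatching_excursionSwap {m : ℕ} {O : Finset ℕ} {h : ℕ → ℤ}
    (hmem : ∀ i ∈ O, 1 ≤ i ∧ i ≤ m) (hup : ∀ i, i + 1 ∈ O → h (i + 1) = h i + 1)
    (hdown : ∀ i, i + 1 ∉ O → h (i + 1) = h i - 1) (hnn : ∀ i ≤ m, 0 ≤ h i)
    (hge : ∀ i, m ≤ i → h i = m - i) (h0 : h 0 = 0) :
    IsCrossinglessMatching m (excursionSwap h) ∧ ∀ i, i < excursionSwap h i ↔ i ∈ O := by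
  have hs : ∀ i, h i ≤ h (i + 1) + 1 := fun i => by
    by_cases hi : i + 1 ∈ O
    · rw [hup i hi]; omega
    · rw [hdown i hi]; omega
  have hs' : ∀ i, h (i + 1) ≤ h i + 1 := fun i => by
    by_cases hi : i + 1 ∈ O
    · rw [hup i hi]
    · rw [hdown i hi]; omega
  have hmem_iff : ∀ i, 1 ≤ i → (i ∈ O ↔ h (i - 1) < h i) := by
    intro i hi
    obtain ⟨p, rfl⟩ := Nat.exists_eq_add_of_le' hi
    rw [Nat.add_sub_cancel]
    by_cases hp : p + 1 ∈ O
    · have := hup p hp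
      exact iff_of_true hp (by omega)
    · have := hdown p hp
      exact iff_of_false hp (by omega)
  have hm := hge m le_rfl
  have hopen : ∀ i ∈ O, ∃ j ≤ m, IsExcursion h i j := fun i hi => by
    have hi' := hmem i hi
    have := hnn (i - 1) (by omega)
    exact exists_isExcursion_right hs hi'.1 hi'.2 ((hmem_iff i hi'.1).1 hi) (by omega)
  have hclose : ∀ j, 1 ≤ j → j ≤ m → j ∉ O → ∃ i, IsExcursion h i j := fun j h1 h2 hj => by
    have := hnn j h2
    refine exists_isExcursion_left hs' h1 ?_ (by omega)
    have := hdown (j - 1)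
    rw [Nat.sub_add_cancel h1] at this
    have := this hj
    omega
  have hpair : ∀ i, 1 ≤ i → i ≤ m → ∃ p q, IsExcursion h p q ∧ q ≤ m ∧ (i = p ∨ i = q) := by
    intro i h1 h2
    by_cases hi : i ∈ O
    · obtain ⟨j, hj, hij⟩ := hopen i hi
      exact ⟨i, j, hij, hj, Or.inl rfl⟩
    · obtain ⟨j, hij⟩ := hclose i h1 h2 hi
      exact ⟨j, i, hij, h2, Or.inr rfl⟩
  refine ⟨⟨?_, ?_, ?_, ?_, ?_⟩, fun i => ⟨fun hi => ?_, fun hi => ?_⟩⟩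
  · intro i h1 h2
    obtain ⟨p, q, hpq, hq, rfl | rfl⟩ := hpair i h1 h2
    · rw [excursionSwap_left hpq]
      have := hpq.2.1; omega
    · rw [excursionSwap_right hpq]
      have := hpq.1; have := hpq.2.1; omega
  · intro i h1 h2
    obtain ⟨p, q, hpq, hq, rfl | rfl⟩ := hpair i h1 h2
    · rw [excursionSwap_left hpq, excursionSwap_right hpq]
    · rw [excursionSwap_right hpq, excursionSwap_left hpq]
  · intro i h1 h2
    obtain ⟨p, q, hpq, hq, rfl | rfl⟩ := hpair i h1 h2
    · rw [excursionSwap_left hpq]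
      have := hpq.2.1; omega
    · rw [excursionSwap_right hpq]
      have := hpq.2.1; omega
  · intro i j h1 hij hja hlt
    have hi := isExcursion_of_lt_excursionSwap (hij.trans hja)
    have hj := isExcursion_of_lt_excursionSwap (hja.trans hlt)
    have h2 := hi.2.2.2 (j - 1) (by omega) (by omega)
    have h3 := hj.2.2.2 _ hja.le hlt
    have h4 := hj.2.2.1
    omega
  · intro i hi
    refine excursionSwap_of_not ?_ ?_
    · rintro ⟨j, hij⟩
      have := hmem i ((hmem_iff i hij.1).2 hij.lt_left)
      omega
    · rintro ⟨p, hpi⟩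
      have h1 := hmem p ((hmem_iff p hpi.1).2 hpi.lt_left)
      have h2 := hpi.2.1
      have h3 := hpi.2.2.1
      have h4 := hnn (p - 1) (by omega)
      have h5 := hge i (by omega)
      omega
  · have hij := isExcursion_of_lt_excursionSwap hi
    exact (hmem_iff i hij.1).2 hij.lt_left
  · obtain ⟨j, -, hij⟩ := hopen i hi
    rw [excursionSwap_left hij]
    exact hij.2.1

/-- Every set of points satisfying the ballot condition is the set of points matched to a larger
point in some crossingless matching. -/
theorem exists_isCrossinglessMatching {m : ℕ} {O : Finset ℕ} (hO : O ⊆ Finset.Icc 1 m)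
    (hb : ∀ i ≤ m, i ≤ 2 * (O.filter (· ≤ i)).card) (hc : 2 * O.card = m) :
    ∃ a, IsCrossinglessMatching m a ∧ ∀ i, i < a i ↔ i ∈ O := by
  obtain ⟨h, hh⟩ : ∃ h : ℕ → ℤ, ∀ i, h i = 2 * ((O.filter (· ≤ i)).card : ℤ) - i :=
    ⟨_, fun _ => rfl⟩
  have hmem : ∀ i ∈ O, 1 ≤ i ∧ i ≤ m := fun i hi => Finset.mem_Icc.1 (hO hi)
  have hup : ∀ i, i + 1 ∈ O → h (i + 1) = h i + 1 := fun i hi => by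
    have : O.filter (· ≤ i + 1) = insert (i + 1) (O.filter (· ≤ i)) := by
      ext x; simp only [Finset.mem_filter, Finset.mem_insert, Nat.le_succ_iff]
      constructor
      · rintro ⟨h1, h2 | h2⟩
        exacts [Or.inr ⟨h1, h2⟩, Or.inl h2]
      · rintro (rfl | ⟨h1, h2⟩)
        exacts [⟨hi, Or.inr rfl⟩, ⟨h1, Or.inl h2⟩]
    rw [hh, hh, this, Finset.card_insert_of_notMem (by simp)]
    push_cast; ring
  have hdown : ∀ i, i + 1 ∉ O → h (i + 1) = h i - 1 := fun i hi => by
    have : O.filter (· ≤ i + 1) = O.filter (· ≤ i) := Finset.filter_congr fun x hx => by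
      have : x ≠ i + 1 := by rintro rfl; exact hi hx
      omega
    rw [hh, hh, this]
    push_cast; ring
  refine ⟨_, isCrossinglessMatching_excursionSwap hmem hup hdown (fun i hi => ?_)
    (fun i hi => ?_) ?_⟩
  · have := hb i hi
    rw [hh]; omega
  · rw [hh, Finset.filter_true_of_mem fun x hx => (hmem x hx).2.trans hi]
    omega
  · have : O.filter (· ≤ 0) = ∅ := by
      rw [Finset.filter_eq_empty_iff]
      intro x hx
      have := (hmem x hx).1
      omega
    rw [hh, this, Finset.card_empty]
    rfl

theorem mem_middleUpSet {n k : ℕ} {a : ℕ → ℕ} {i : ℕ} :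
    i ∈ middleUpSet n k a ↔ (n - k + 1 ≤ i ∧ i ≤ 2 * n - k) ∧ i < a i := by
  simp [middleUpSet]

theorem IsPlatformMatching.lt_apply_iff {n k : ℕ} (hk : k ≤ n) {a : ℕ → ℕ}
    (ha : IsPlatformMatching n (n - k) k a) {i : ℕ} (h1 : 1 ≤ i) (h2 : i ≤ 2 * n) :
    i < a i ↔ i ≤ n - k ∨ i ∈ middleUpSet n k a := by
  obtain ⟨⟨hr, -, hf, -, -⟩, hfirst, hlast⟩ := ha
  have hr := hr i h1 (by omega)
  have hf := hf i h1 (by omega)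
  rw [mem_middleUpSet]
  by_cases h3 : i ≤ n - k
  · have : i < a i := by
      by_contra h
      exact hfirst i (a i) h1 h3 hr.1 (by omega) (Ne.symm hf) rfl
    omega
  · by_cases h4 : i ≤ 2 * n - k
    · omega
    · have : ¬ i < a i := fun h =>
        hlast i (a i) (by omega) (by omega) (by omega) (by omega) (Ne.symm hf) rfl
      omega

theorem card_Icc_union_middle {n k : ℕ} {S : Finset ℕ}
    (hS : S ⊆ Finset.Icc (n - k + 1) (2 * n - k)) :
    (Finset.Icc 1 (n - k) ∪ S).card = n - k + S.card := by
  rw [Finset.card_union_of_disjoint, Nat.card_Icc, Nat.add_sub_cancel]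
  refine Finset.disjoint_left.2 fun x hx hx' => ?_
  have := Finset.mem_Icc.1 (hS hx')
  have := Finset.mem_Icc.1 hx
  omega

theorem middleUpSet_subset (n k : ℕ) (a : ℕ → ℕ) :
    middleUpSet n k a ⊆ Finset.Icc (n - k + 1) (2 * n - k) :=
  Finset.filter_subset _ _

theorem IsPlatformMatching.card_middleUpSet {n k : ℕ} (hk : k ≤ n) {a : ℕ → ℕ}
    (ha : IsPlatformMatching n (n - k) k a) : (middleUpSet n k a).card = k := by
  have h1 := ha.1.two_mul_card_openers
  have h2 : (Finset.Icc 1 (n + (n - k) + k)).filter (fun i => i < a i) =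
      Finset.Icc 1 (n - k) ∪ middleUpSet n k a := by
    ext i
    rw [Finset.mem_filter, Finset.mem_union, Finset.mem_Icc, Finset.mem_Icc]
    constructor
    · rintro ⟨⟨h3, h4⟩, h5⟩
      exact ((ha.lt_apply_iff hk h3 (by omega)).1 h5).imp_left fun h => ⟨h3, h⟩
    · intro h
      have h3 : 1 ≤ i ∧ i ≤ 2 * n := by
        rcases h with h | h
        · omega
        · have := mem_middleUpSet.1 h
          omega
      have := (ha.lt_apply_iff hk h3.1 h3.2).2 (h.imp_left And.right)
      omega
  rw [h2, card_Icc_union_middle (middleUpSet_subset n k a)] at h1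
  omega

/-- The first `n - k` points together with `k` middle points satisfy the ballot condition. -/
theorem le_two_mul_card_filter_Icc_union {n k : ℕ} (hk : k ≤ n) {S : Finset ℕ}
    (hS : S ⊆ Finset.Icc (n - k + 1) (2 * n - k)) (hc : S.card = k) {i : ℕ} (hi : i ≤ 2 * n) :
    i ≤ 2 * ((Finset.Icc 1 (n - k) ∪ S).filter (· ≤ i)).card := by
  by_cases h1 : i ≤ n - k
  · have : Finset.Icc 1 i ⊆ (Finset.Icc 1 (n - k) ∪ S).filter (· ≤ i) := by
      intro x hx
      simp only [Finset.mem_filter, Finset.mem_union, Finset.mem_Icc] at hx ⊢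
      omega
    have := Finset.card_le_card this
    simp only [Nat.card_Icc] at this
    omega
  · have h2 : Finset.Icc 1 (n - k) ∪ S.filter (· ≤ i) ⊆
        (Finset.Icc 1 (n - k) ∪ S).filter (· ≤ i) := by
      intro x hx
      simp only [Finset.mem_filter, Finset.mem_union, Finset.mem_Icc] at hx ⊢
      grind
    have h3 := Finset.card_le_card h2
    rw [card_Icc_union_middle ((Finset.filter_subset _ _).trans hS)] at h3
    have h4 := Finset.card_filter_add_card_filter_not (s := S) (· ≤ i)
    have h5 : S.filter (fun x => ¬ x ≤ i) ⊆ Finset.Icc (i + 1) (2 * n - k) := by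
      intro x hx
      rw [Finset.mem_filter] at hx
      have := Finset.mem_Icc.1 (hS hx.1)
      rw [Finset.mem_Icc]
      omega
    have h6 := Finset.card_le_card h5
    rw [Nat.card_Icc] at h6
    omega

theorem exists_isPlatformMatching_middleUpSet_eq {n k : ℕ} (hk : k ≤ n) {S : Finset ℕ}
    (hS : S ⊆ Finset.Icc (n - k + 1) (2 * n - k)) (hc : S.card = k) :
    ∃ a, IsPlatformMatching n (n - k) k a ∧ middleUpSet n k a = S := by
  have hmem : ∀ i, i ∈ Finset.Icc 1 (n - k) ∪ S ↔ (1 ≤ i ∧ i ≤ n - k) ∨ i ∈ S := by simp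
  have hS' : ∀ i ∈ S, n - k + 1 ≤ i ∧ i ≤ 2 * n - k := fun i hi => Finset.mem_Icc.1 (hS hi)
  have hcard := card_Icc_union_middle hS
  obtain ⟨a, ha, hO⟩ := exists_isCrossinglessMatching (m := n + (n - k) + k)
    (O := Finset.Icc 1 (n - k) ∪ S)
    (fun i hi => by
      rw [Finset.mem_Icc]
      rcases (hmem i).1 hi with h | h
      · omega
      · have := hS' i h; omega)
    (fun i hi => le_two_mul_card_filter_Icc_union hk hS hc (by omega))
    (by omega)
  refine ⟨a, ⟨ha, ?_, ?_⟩, ?_⟩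
  · intro i j h1 h2 h3 h4 _ hij
    have h5 := (hO i).2 ((hmem i).2 (by omega))
    have h6 := (hO j).2 ((hmem j).2 (by omega))
    have h7 := ha.2.1 i h1 (by omega)
    rw [hij] at h5 h7
    omega
  · intro i j h1 h2 h3 h4 hne hij
    have hlast : ∀ l, n + (n - k) + 1 ≤ l → ¬ l < a l := fun l hl h => by
      rcases (hmem l).1 ((hO l).1 h) with h | h
      · omega
      · have := hS' l h; omega
    have h5 := hlast i h1
    have h6 := hlast j h3
    have h7 := ha.2.1 i (by omega) (by omega)
    rw [hij] at h5 h7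
    omega
  · ext i
    rw [mem_middleUpSet, hO, hmem]
    constructor
    · rintro ⟨h1, h2 | h2⟩
      · omega
      · exact h2
    · exact fun h => ⟨hS' i h, Or.inr h⟩

/-- For every `a ∈ B(n;n−k,k)` the set `S_a` of middle points matched to a
strictly larger point has exactly `k` elements, and `a ↦ S_a` is a bijection
from `B(n;n−k,k)` onto the `k`-element subsets of the middle points. -/
theorem platformMatching_bijOn_subsets (n k : ℕ) (hk : k ≤ n) :
    (∀ a : ℕ → ℕ, IsPlatformMatching n (n - k) k a → (middleUpSet n k a).card = k) ∧
    Set.BijOn (middleUpSet n k)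
      {a : ℕ → ℕ | IsPlatformMatching n (n - k) k a}
      {S : Finset ℕ | S ⊆ Finset.Icc (n - k + 1) (2 * n - k) ∧ S.card = k} := by
  refine ⟨fun a ha => ha.card_middleUpSet hk, ⟨fun a ha => ?_, fun a ha b hb hab => ?_, ?_⟩⟩
  · exact ⟨middleUpSet_subset n k a, IsPlatformMatching.card_middleUpSet hk ha⟩
  · refine IsCrossinglessMatching.ext_openers ha.1 hb.1 fun i h1 h2 => ?_
    rw [ha.lt_apply_iff hk h1 (by omega), hb.lt_apply_iff hk h1 (by omega), hab]
  · rintro S ⟨hS, hc⟩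
    exact exists_isPlatformMatching_middleUpSet_eq hk hS hc
end
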